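/- arXiv:2112.09822 — 2 statements merged into one kernel-verified Lean document; each statement's English description precedes it below -/
import Mathlib

section
/- Let d, M ≥ 1, let σ_1, …, σ_M > 0, and let μ be a probability measure on ℝ^d with ∫ ‖x‖ dμ(x) < ∞. Define the Gaussian M-density p_Y(y) = ∫ ∏_{m=1}^M (2πσ_m²)^{-d/2} exp(−‖y_m − x‖²/(2σ_m²)) dμ(x) and the multimeasurement Bayes estimator x̂(y) = p_Y(y)^{-1} ∫ x ∏_{m=1}^M (2πσ_m²)^{-d/2} exp(−‖y_m − x‖²/(2σ_m²)) dμ(x). Then p_Y(y) > 0 for every y ∈ (ℝ^d)^M, and for every m ∈ {1,…,M} one has x̂(y) = y_m + σ_m² ∇_{y_m} log p_Y(y), i.e. x̂(y) = y_m + σ_m² (∇_{y_m} p_Y(y))/p_Y(y). -/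
open MeasureTheory Finset

/-- The Gaussian multimeasurement noise-model kernel
`p(y|x) = ∏_{m=1}^M (2πσ_m²)^{-d/2} exp(−‖y_m − x‖²/(2σ_m²))`. -/
noncomputable def mnmKernel (d M : ℕ) (σ : Fin M → ℝ)
    (y : Fin M → EuclideanSpace ℝ (Fin d)) (x : EuclideanSpace ℝ (Fin d)) : ℝ :=
  ∏ m, (2 * Real.pi * σ m ^ 2) ^ (-(d : ℝ) / 2) *
    Real.exp (-‖y m - x‖ ^ 2 / (2 * σ m ^ 2))

/-- The Gaussian M-density `p_Y(y) = ∫ p(y|x) dμ(x)`. -/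
noncomputable def mDensity (d M : ℕ) (σ : Fin M → ℝ)
    (μ : Measure (EuclideanSpace ℝ (Fin d))) (y : Fin M → EuclideanSpace ℝ (Fin d)) : ℝ :=
  ∫ x, mnmKernel d M σ y x ∂μ

lemma mnmKernel_pos (d M : ℕ) (σ : Fin M → ℝ) (hσ : ∀ m, 0 < σ m)
    (y : Fin M → EuclideanSpace ℝ (Fin d)) (x : EuclideanSpace ℝ (Fin d)) :
    0 < mnmKernel d M σ y x := by
  refine Finset.prod_pos fun m _ => ?_
  have := hσ m
  positivity

lemma mnmKernel_le (d M : ℕ) (σ : Fin M → ℝ)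
    (y : Fin M → EuclideanSpace ℝ (Fin d)) (x : EuclideanSpace ℝ (Fin d)) :
    mnmKernel d M σ y x ≤ ∏ m, (2 * Real.pi * σ m ^ 2) ^ (-(d : ℝ) / 2) := by
  refine Finset.prod_le_prod (fun m _ => by positivity) fun m _ => ?_
  refine mul_le_of_le_one_right (by positivity) (Real.exp_le_one_iff.2 ?_)
  rw [neg_div]
  exact neg_nonpos.2 (by positivity)

lemma continuous_mnmKernel (d M : ℕ) (σ : Fin M → ℝ)
    (y : Fin M → EuclideanSpace ℝ (Fin d)) : Continuous (mnmKernel d M σ y) := by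
  unfold mnmKernel
  fun_prop

lemma integrable_mnmKernel (d M : ℕ) (σ : Fin M → ℝ) (hσ : ∀ m, 0 < σ m)
    (μ : Measure (EuclideanSpace ℝ (Fin d))) [IsFiniteMeasure μ]
    (y : Fin M → EuclideanSpace ℝ (Fin d)) : Integrable (mnmKernel d M σ y) μ := by
  refine Integrable.of_bound (continuous_mnmKernel d M σ y).aestronglyMeasurable
    (∏ m, (2 * Real.pi * σ m ^ 2) ^ (-(d : ℝ) / 2)) (ae_of_all _ fun x => ?_)
  rw [Real.norm_of_nonneg (mnmKernel_pos d M σ hσ y x).le]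
  exact mnmKernel_le d M σ y x

lemma mDensity_pos (d M : ℕ) (σ : Fin M → ℝ) (hσ : ∀ m, 0 < σ m)
    (μ : Measure (EuclideanSpace ℝ (Fin d))) [IsProbabilityMeasure μ]
    (y : Fin M → EuclideanSpace ℝ (Fin d)) : 0 < mDensity d M σ μ y := by
  refine (integral_pos_iff_support_of_nonneg (fun x => (mnmKernel_pos d M σ hσ y x).le)
    (integrable_mnmKernel d M σ hσ μ y)).2 ?_
  have : Function.support (mnmKernel d M σ y) = Set.univ :=
    Set.eq_univ_of_forall fun x => (mnmKernel_pos d M σ hσ y x).ne'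
  simp [this]

lemma integrable_mnmKernel_smul (d M : ℕ) (σ : Fin M → ℝ) (hσ : ∀ m, 0 < σ m)
    (μ : Measure (EuclideanSpace ℝ (Fin d))) (hmom : Integrable (fun x => ‖x‖) μ)
    (y : Fin M → EuclideanSpace ℝ (Fin d)) :
    Integrable (fun x => mnmKernel d M σ y x • x) μ := by
  refine (hmom.const_mul (∏ m, (2 * Real.pi * σ m ^ 2) ^ (-(d : ℝ) / 2))).mono'
    ((continuous_mnmKernel d M σ y).smul continuous_id).aestronglyMeasurable
    (ae_of_all _ fun x => ?_)
  rw [norm_smul, Real.norm_of_nonneg (mnmKernel_pos d M σ hσ y x).le]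
  gcongr
  exact mnmKernel_le d M σ y x

/-- The gradient of the kernel in one channel is the kernel times the Gaussian score. -/
lemma hasFDerivAt_mnmKernel_update (d M : ℕ) (σ : Fin M → ℝ)
    (y : Fin M → EuclideanSpace ℝ (Fin d)) (m : Fin M) (x z : EuclideanSpace ℝ (Fin d)) :
    HasFDerivAt (fun z => mnmKernel d M σ (Function.update y m z) x)
      (innerSL ℝ ((mnmKernel d M σ (Function.update y m z) x * (σ m ^ 2)⁻¹) • (x - z))) z := by
  obtain ⟨A, hA⟩ : ∃ A : ℝ, ∀ w, mnmKernel d M σ (Function.update y m w) x =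
      A * Real.exp (-‖w - x‖ ^ 2 / (2 * σ m ^ 2)) := by
    refine ⟨(2 * Real.pi * σ m ^ 2) ^ (-(d : ℝ) / 2) *
      ∏ i ∈ univ.erase m, (2 * Real.pi * σ i ^ 2) ^ (-(d : ℝ) / 2) *
        Real.exp (-‖y i - x‖ ^ 2 / (2 * σ i ^ 2)), fun w => ?_⟩
    rw [mnmKernel, ← Finset.mul_prod_erase univ _ (mem_univ m), Function.update_self,
      Finset.prod_congr rfl fun i hi => by
        rw [Function.update_of_ne (Finset.ne_of_mem_erase hi)]]
    ring
  simp_rw [hA]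
  have hsq : HasFDerivAt (fun w : EuclideanSpace ℝ (Fin d) => ‖w - x‖ ^ 2)
      (2 • innerSL ℝ (z - x)) z := by
    simpa using ((hasFDerivAt_id z).sub_const x).norm_sq
  have h := ((hsq.neg.mul_const (2 * σ m ^ 2)⁻¹).exp).const_mul A
  simp_rw [← div_eq_mul_inv] at h
  refine h.congr_fderiv ?_
  ext v
  simp
  ring

lemma hasGradientAt_mDensity_update (d M : ℕ) (σ : Fin M → ℝ) (hσ : ∀ m, 0 < σ m)
    (μ : Measure (EuclideanSpace ℝ (Fin d))) [IsFiniteMeasure μ]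
    (hmom : Integrable (fun x => ‖x‖) μ)
    (y : Fin M → EuclideanSpace ℝ (Fin d)) (m : Fin M) :
    HasGradientAt (fun z => mDensity d M σ μ (Function.update y m z))
      ((σ m ^ 2)⁻¹ • ((∫ x, mnmKernel d M σ y x • x ∂μ) - mDensity d M σ μ y • y m)) (y m) := by
  set C : ℝ := ∏ i, (2 * Real.pi * σ i ^ 2) ^ (-(d : ℝ) / 2)
  set G : EuclideanSpace ℝ (Fin d) → EuclideanSpace ℝ (Fin d) → EuclideanSpace ℝ (Fin d) :=
    fun z x => (mnmKernel d M σ (Function.update y m z) x * (σ m ^ 2)⁻¹) • (x - z) with hG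
  have hG_cont (z) : Continuous (G z) :=
    ((continuous_mnmKernel d M σ _).mul_const _).smul (continuous_id.sub continuous_const)
  have hG_le (x) (z) (hz : z ∈ Metric.ball (y m) 1) :
      ‖G z x‖ ≤ C * (σ m ^ 2)⁻¹ * (‖x‖ + (‖y m‖ + 1)) := by
    have hz' : ‖z‖ ≤ ‖y m‖ + 1 := by
      have := norm_le_norm_add_norm_sub (y m) z
      rw [Metric.mem_ball, dist_eq_norm, norm_sub_rev] at hz
      linarith
    have hK := mnmKernel_pos d M σ hσ (Function.update y m z) x
    rw [hG, norm_smul, Real.norm_of_nonneg (by positivity)]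
    gcongr
    · exact mnmKernel_le d M σ _ x
    · exact (norm_sub_le x z).trans (by gcongr)
  have hbound : Integrable (fun x => C * (σ m ^ 2)⁻¹ * (‖x‖ + (‖y m‖ + 1))) μ :=
    (hmom.add (integrable_const _)).const_mul _
  have hG_int : Integrable (G (y m)) μ :=
    hbound.mono' (hG_cont _).aestronglyMeasurable
      (ae_of_all _ fun x => hG_le x _ (Metric.mem_ball_self one_pos))
  have key : HasFDerivAt (fun z => mDensity d M σ μ (Function.update y m z))
      (∫ x, innerSL ℝ (G (y m) x) ∂μ) (y m) :=
    hasFDerivAt_integral_of_dominated_of_fderiv_le (Metric.ball_mem_nhds (y m) one_pos)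
      (Filter.Eventually.of_forall fun z => (continuous_mnmKernel d M σ _).aestronglyMeasurable)
      (integrable_mnmKernel d M σ hσ μ _)
      ((innerSL ℝ).continuous.comp (hG_cont (y m))).aestronglyMeasurable
      (ae_of_all _ fun x z hz => (innerSL_apply_norm ℝ (G z x)).trans_le (hG_le x z hz))
      hbound
      (ae_of_all _ fun x z _ => hasFDerivAt_mnmKernel_update d M σ y m x z)
  rw [(innerSL ℝ).integral_comp_comm hG_int] at key
  have hval : ∫ x, G (y m) x ∂μ =
      (σ m ^ 2)⁻¹ • ((∫ x, mnmKernel d M σ y x • x ∂μ) - mDensity d M σ μ y • y m) := by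
    rw [mDensity, ← integral_smul_const,
      ← integral_sub (integrable_mnmKernel_smul d M σ hσ μ hmom y)
        ((integrable_mnmKernel d M σ hσ μ y).smul_const _), ← integral_smul]
    refine integral_congr_ae (ae_of_all _ fun x => ?_)
    simp only [hG, Function.update_eq_self]
    module
  rw [hval] at key
  exact key

/-- Multimeasurement Miyasawa identity: `p_Y(y) > 0` and
`x̂(y) = y_m + σ_m² (∇_{y_m} p_Y(y))/p_Y(y)` for every channel `m`. -/
theorem bayes_estimator_eq_score (d M : ℕ) (hd : 1 ≤ d) (hM : 1 ≤ M)
    (σ : Fin M → ℝ) (hσ : ∀ m, 0 < σ m)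
    (μ : Measure (EuclideanSpace ℝ (Fin d))) [IsProbabilityMeasure μ]
    (hmom : Integrable (fun x => ‖x‖) μ)
    (y : Fin M → EuclideanSpace ℝ (Fin d)) :
    0 < mDensity d M σ μ y ∧
      ∀ m : Fin M,
        (mDensity d M σ μ y)⁻¹ • (∫ x, mnmKernel d M σ y x • x ∂μ)
          = y m + (σ m ^ 2) •
              ((mDensity d M σ μ y)⁻¹ •
                gradient (fun z => mDensity d M σ μ (Function.update y m z)) (y m)) := by
  have hpos := mDensity_pos d M σ hσ μ y
  refine ⟨hpos, fun m => ?_⟩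
  have hσm : σ m ^ 2 ≠ 0 := pow_ne_zero 2 (hσ m).ne'
  rw [(hasGradientAt_mDensity_update d M σ hσ μ hmom y m).gradient, smul_comm (σ m ^ 2),
    smul_inv_smul₀ hσm, smul_sub, inv_smul_smul₀ hpos.ne', add_sub_cancel]
end

section
/- Let γ > 0, δ > 0, u > 0, and set Σ_yy = γ^{-1}u(2δ − 4γ^{-1}(1 − e^{-γδ}) + γ^{-1}(1 − e^{-2γδ})), Σ_vv = u(1 − e^{-2γδ}), and Σ_yv = γ^{-1}u(1 − 2e^{-γδ} + e^{-2γδ}). Then Σ_yy > 0 and Σ_yv² ≤ Σ_yy · Σ_vv. -/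
/-- The inequality `tanh (t / 2) ≤ t / 2` for `0 ≤ t`, written in terms of `exp (-t)`. -/
lemma two_mul_one_sub_exp_neg_le {t : ℝ} (ht : 0 ≤ t) :
    2 * (1 - Real.exp (-t)) ≤ t * (1 + Real.exp (-t)) := by
  have h := Real.le_log_one_add_of_nonneg (sub_nonneg.2 (Real.one_le_exp ht))
  have hpos := Real.exp_pos t
  rw [add_sub_cancel, Real.log_exp, div_le_iff₀ (by linarith)] at h
  have hmul : Real.exp t * Real.exp (-t) = 1 := by rw [← Real.exp_add]; simp
  linear_combination Real.exp (-t) * h + (t - 2) * hmul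


/-- Positive semidefiniteness of the 2×2 conditional covariance matrix of the
underdamped Langevin diffusion over one step of length `δ`. -/
theorem langevin_covariance_psd (γ δ u : ℝ) (hγ : 0 < γ) (hδ : 0 < δ) (hu : 0 < u)
    (Syy Svv Syv : ℝ)
    (hSyy : Syy = γ⁻¹ * u * (2 * δ - 4 * γ⁻¹ * (1 - Real.exp (-γ * δ))
      + γ⁻¹ * (1 - Real.exp (-2 * γ * δ))))
    (hSvv : Svv = u * (1 - Real.exp (-2 * γ * δ)))
    (hSyv : Syv = γ⁻¹ * u * (1 - 2 * Real.exp (-γ * δ) + Real.exp (-2 * γ * δ))) :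
    0 < Syy ∧ Syv ^ 2 ≤ Syy * Svv := by
  have hx2 : Real.exp (-2 * γ * δ) = Real.exp (-γ * δ) ^ 2 := by
    rw [← Real.exp_nat_mul]; congr 1; push_cast; ring
  have ht : 0 < γ * δ := mul_pos hγ hδ
  have key := two_mul_one_sub_exp_neg_le ht.le
  have hx1 : Real.exp (-(γ * δ)) < 1 := Real.exp_lt_one_iff.mpr (by linarith)
  have hx0 := Real.exp_pos (-(γ * δ))
  rw [hx2] at hSyy hSvv hSyv
  rw [neg_mul] at hSyy hSvv hSyv
  generalize Real.exp (-(γ * δ)) = x at *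
  have hle : Syv ^ 2 ≤ Syy * Svv := by
    have hdiff : Syy * Svv - Syv ^ 2 =
        2 * (γ⁻¹ * u) ^ 2 * (1 - x) * (γ * δ * (1 + x) - 2 * (1 - x)) := by
      rw [hSyy, hSvv, hSyv]
      field_simp
      ring
    have : 0 ≤ 1 - x := by linarith
    have : 0 ≤ γ * δ * (1 + x) - 2 * (1 - x) := by linarith
    rw [← sub_nonneg, hdiff]
    positivity
  have hSvv_pos : 0 < Svv := hSvv ▸ mul_pos hu (by nlinarith)
  have hSyv_pos : 0 < Syv := by
    have : 0 < 1 - x := by linarith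
    rw [hSyv, show 1 - 2 * x + x ^ 2 = (1 - x) ^ 2 by ring]
    positivity
  exact ⟨pos_of_mul_pos_left ((pow_pos hSyv_pos 2).trans_le hle) hSvv_pos.le, hle⟩
end
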